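/- (Output part of Theorem 1.) Fix σ > 0, constants D > 0, m > 0, and μ̄ ∈ ℝ, and define total output y(μ) = D · m · e^{μ̄ + σ²/2} · (1 - Φ((μ - σ²)/σ)) / (1 - Φ(μ/σ)) for μ ∈ ℝ, where Φ is the standard normal cumulative distribution function. Then for any two ability thresholds μ_H > μ_L, one has y(μ_H) > y(μ_L); that is, the total output associated with the higher data investment ability strictly exceeds the total output associated with the lower data investment ability. -/

import Mathlib

open Real MeasureTheory

/-- The probability density function of the standard normal distribution. -/
noncomputable def stdNormalPDF (x : ℝ) : ℝ :=
  (Real.sqrt (2 * Real.pi))⁻¹ * Real.exp (-x ^ 2 / 2)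

/-- The cumulative distribution function of the standard normal distribution. -/
noncomputable def stdNormalCDF (x : ℝ) : ℝ :=
  ∫ t in Set.Iic x, stdNormalPDF t

lemma stdNormalPDF_eq_gaussianPDFReal :
    stdNormalPDF = ProbabilityTheory.gaussianPDFReal 0 1 := by
  ext x
  simp [stdNormalPDF, ProbabilityTheory.gaussianPDFReal]

lemma integrable_stdNormalPDF : Integrable stdNormalPDF :=
  stdNormalPDF_eq_gaussianPDFReal ▸ ProbabilityTheory.integrable_gaussianPDFReal 0 1

lemma integral_stdNormalPDF : ∫ x, stdNormalPDF x = 1 :=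
  stdNormalPDF_eq_gaussianPDFReal ▸
    ProbabilityTheory.integral_gaussianPDFReal_eq_one 0 one_ne_zero

lemma stdNormalPDF_pos (x : ℝ) : 0 < stdNormalPDF x := by
  unfold stdNormalPDF
  positivity

lemma continuous_stdNormalPDF : Continuous stdNormalPDF := by
  unfold stdNormalPDF
  fun_prop

lemma one_sub_stdNormalCDF (x : ℝ) :
    1 - stdNormalCDF x = ∫ t in Set.Ioi x, stdNormalPDF t := by
  rw [← integral_stdNormalPDF, stdNormalCDF, ← intervalIntegral.integral_Iic_add_Ioi
    (b := x) integrable_stdNormalPDF.integrableOn integrable_stdNormalPDF.integrableOn]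
  ring

lemma one_sub_stdNormalCDF_pos (x : ℝ) : 0 < 1 - stdNormalCDF x := by
  rw [one_sub_stdNormalCDF, setIntegral_pos_iff_support_of_nonneg_ae
    (.of_forall fun t ↦ (stdNormalPDF_pos t).le) integrable_stdNormalPDF.integrableOn]
  have : Function.support stdNormalPDF = Set.univ :=
    Set.eq_univ_of_forall fun t ↦ (stdNormalPDF_pos t).ne'
  simp [this]

lemma one_sub_stdNormalCDF_sub (x s : ℝ) :
    1 - stdNormalCDF (x - s) = ∫ t in Set.Ioi x, stdNormalPDF (t - s) := by
  have h := (measurePreserving_sub_right volume s).setIntegral_preimage_emb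
    (MeasurableEquiv.subRight s).measurableEmbedding stdNormalPDF (Set.Ioi (x - s))
  rw [one_sub_stdNormalCDF, ← h]
  simp

lemma stdNormalPDF_sub (t s : ℝ) :
    stdNormalPDF (t - s) = Real.exp (s * t - s ^ 2 / 2) * stdNormalPDF t := by
  unfold stdNormalPDF
  rw [mul_left_comm, ← Real.exp_add]
  ring_nf

/-- A positive shift of the standard normal survival function, divided by the function itself,
is strictly increasing: the likelihood ratio of the two densities is increasing. -/
lemma strictMono_one_sub_stdNormalCDF_ratio {s : ℝ} (hs : 0 < s) :
    StrictMono fun x ↦ (1 - stdNormalCDF (x - s)) / (1 - stdNormalCDF x) := by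
  intro a b hab
  have hint : Integrable fun t ↦ stdNormalPDF (t - s) := integrable_stdNormalPDF.comp_sub_right s
  have hcont : Continuous fun t ↦ stdNormalPDF (t - s) := by
    have := continuous_stdNormalPDF
    fun_prop
  have split {f : ℝ → ℝ} (hf : Integrable f) :
      ∫ t in Set.Ioi a, f t = (∫ t in a..b, f t) + ∫ t in Set.Ioi b, f t :=
    (intervalIntegral.integral_interval_add_Ioi hf.integrableOn hf.integrableOn).symm
  let w := Real.exp (s * b - s ^ 2 / 2)
  have hA : ∫ t in a..b, stdNormalPDF (t - s) < w * ∫ t in a..b, stdNormalPDF t := by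
    rw [← intervalIntegral.integral_const_mul]
    refine intervalIntegral.integral_lt_integral_of_continuousOn_of_le_of_exists_lt hab
      hcont.continuousOn (continuous_stdNormalPDF.const_mul w).continuousOn (fun t ht ↦ ?_)
      ⟨a, Set.left_mem_Icc.2 hab.le, ?_⟩
    · rw [stdNormalPDF_sub]
      have := (stdNormalPDF_pos t).le
      have := ht.2
      unfold w
      gcongr
    · rw [stdNormalPDF_sub]
      have := stdNormalPDF_pos a
      unfold w
      gcongr
  have hB : w * ∫ t in Set.Ioi b, stdNormalPDF t ≤ ∫ t in Set.Ioi b, stdNormalPDF (t - s) := by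
    rw [← integral_const_mul]
    refine setIntegral_mono_on (integrable_stdNormalPDF.const_mul w).integrableOn
      hint.integrableOn measurableSet_Ioi fun t ht ↦ ?_
    rw [stdNormalPDF_sub]
    have := (stdNormalPDF_pos t).le
    have := (Set.mem_Ioi.1 ht).le
    unfold w
    gcongr
  have hA0 : 0 < ∫ t in a..b, stdNormalPDF t :=
    intervalIntegral.intervalIntegral_pos_of_pos
      (continuous_stdNormalPDF.intervalIntegrable a b) stdNormalPDF_pos hab
  have ha := one_sub_stdNormalCDF_pos a
  have hb := one_sub_stdNormalCDF_pos b
  dsimp only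
  rw [div_lt_div_iff₀ ha hb]
  rw [one_sub_stdNormalCDF] at hb
  rw [one_sub_stdNormalCDF_sub, one_sub_stdNormalCDF_sub, one_sub_stdNormalCDF,
    one_sub_stdNormalCDF, split hint, split integrable_stdNormalPDF]
  linarith [mul_lt_mul_of_pos_right hA hb, mul_le_mul_of_nonneg_right hB hA0.le]

/-- Output part of Theorem 1: with total output
`y(μ) = D ⬝ m ⬝ e^{μ̄ + σ²/2} ⬝ (1 - Φ((μ - σ²)/σ)) / (1 - Φ(μ/σ))`,
the higher ability threshold yields strictly higher total output. -/
theorem output_higher_for_higher_ability (σ D m μbar μL μH : ℝ)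
    (hσ : 0 < σ) (hD : 0 < D) (hm : 0 < m) (hLH : μL < μH) :
    D * m * Real.exp (μbar + σ ^ 2 / 2) *
        ((1 - stdNormalCDF ((μL - σ ^ 2) / σ)) / (1 - stdNormalCDF (μL / σ)))
      < D * m * Real.exp (μbar + σ ^ 2 / 2) *
        ((1 - stdNormalCDF ((μH - σ ^ 2) / σ)) / (1 - stdNormalCDF (μH / σ))) := by
  have shift (μ : ℝ) : (μ - σ ^ 2) / σ = μ / σ - σ := by
    field_simp
  rw [shift, shift]
  have h : μL / σ < μH / σ := by gcongr
  exact mul_lt_mul_of_pos_left (strictMono_one_sub_stdNormalCDF_ratio hσ h) (by positivity)
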